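/- arXiv:2312.09605 — 3 statements merged into one kernel-verified Lean document; each statement's English description precedes it below -/
import Mathlib

section
/- Let n = 1 or n = 2. For every α ≥ 0 there exists a constant C > 0 such that for every a ≥ 0, every p ∈ [1,∞] and every Schwartz function f on ℝⁿ, the Fourier multiplier with symbol a^{α/2}|ξ|^α (1 + a|ξ|²)^{-α/2} satisfies ‖a^{α/2}|D|^α (1 + a|D|²)^{-α/2} f‖_{L^p(ℝⁿ)} ≤ C ‖f‖_{L^p(ℝⁿ)}. -/
open MeasureTheory Real Complex
open scoped ENNReal InnerProductSpace

/-- Fourier transform with the convention `f̂(ξ) = (2π)^{-n/2} ∫ e^{-i x·ξ} f(x) dx`. -/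
noncomputable def ft {n : ℕ} (f : EuclideanSpace ℝ (Fin n) → ℂ) (ξ : EuclideanSpace ℝ (Fin n)) : ℂ :=
  (((2 * π) ^ (-(n : ℝ) / 2) : ℝ) : ℂ) *
    ∫ x : EuclideanSpace ℝ (Fin n), Complex.exp (-Complex.I * (⟪x, ξ⟫_ℝ : ℂ)) * f x

/-- Fourier multiplier `m(D) f (x) = (2π)^{-n/2} ∫ e^{i x·ξ} m(ξ) f̂(ξ) dξ`. -/
noncomputable def fmult {n : ℕ} (m : EuclideanSpace ℝ (Fin n) → ℂ)
    (f : EuclideanSpace ℝ (Fin n) → ℂ) (x : EuclideanSpace ℝ (Fin n)) : ℂ :=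
  (((2 * π) ^ (-(n : ℝ) / 2) : ℝ) : ℂ) *
    ∫ ξ : EuclideanSpace ℝ (Fin n), Complex.exp (Complex.I * (⟪x, ξ⟫_ℝ : ℂ)) * m ξ * ft f ξ


open scoped FourierTransform

lemma aux_ft_eq {n : ℕ} (f : SchwartzMap (EuclideanSpace ℝ (Fin n)) ℂ)
    (ξ : EuclideanSpace ℝ (Fin n)) :
    ft (⇑f) ξ = (((2 * π) ^ (-(n : ℝ) / 2) : ℝ) : ℂ) * (𝓕 f) ((2 * π)⁻¹ • ξ) := by
  rw [ft, SchwartzMap.fourier_coe, Real.fourier_eq']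
  congr 1
  apply integral_congr_ae
  refine Filter.Eventually.of_forall fun x => ?_
  simp only [smul_eq_mul]
  congr 2
  rw [inner_smul_right]
  push_cast
  have : (π : ℂ) ≠ 0 := by exact_mod_cast Real.pi_ne_zero
  field_simp

lemma aux_ft_integrable {n : ℕ} (f : SchwartzMap (EuclideanSpace ℝ (Fin n)) ℂ) :
    Integrable (ft (⇑f)) := by
  have h : Integrable (fun ξ : EuclideanSpace ℝ (Fin n) => (𝓕 f) ((2 * π)⁻¹ • ξ)) :=
    (SchwartzMap.integrable (𝓕 f)).comp_smul (by positivity)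
  have h2 : ft (⇑f) = fun ξ => (((2 * π) ^ (-(n : ℝ) / 2) : ℝ) : ℂ) *
      (𝓕 f) ((2 * π)⁻¹ • ξ) := funext (aux_ft_eq f)
  rw [h2]
  exact h.const_mul _

lemma aux_inversion {n : ℕ} (f : SchwartzMap (EuclideanSpace ℝ (Fin n)) ℂ)
    (x : EuclideanSpace ℝ (Fin n)) :
    (((2 * π) ^ (-(n : ℝ) / 2) : ℝ) : ℂ) *
      ∫ ξ : EuclideanSpace ℝ (Fin n), Complex.exp (Complex.I * (⟪x, ξ⟫_ℝ : ℂ)) * ft (⇑f) ξ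
      = f x := by
  have h1 : 𝓕⁻ (𝓕 f) x = f x := by rw [FourierTransform.fourierInv_fourier_eq]
  rw [SchwartzMap.fourierInv_coe, Real.fourierInv_eq'] at h1
  set G : EuclideanSpace ℝ (Fin n) → ℂ :=
    fun v => Complex.exp ((2 * π * ⟪v, x⟫_ℝ : ℝ) * Complex.I) • (𝓕 f) v with hG
  have h2 : ∀ ξ : EuclideanSpace ℝ (Fin n),
      Complex.exp (Complex.I * (⟪x, ξ⟫_ℝ : ℂ)) * ft (⇑f) ξ =
      (((2 * π) ^ (-(n : ℝ) / 2) : ℝ) : ℂ) * G ((2 * π)⁻¹ • ξ) := by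
    intro ξ
    rw [aux_ft_eq, hG]
    simp only [smul_eq_mul]
    rw [inner_smul_left, real_inner_comm x ξ]
    have : (2 * π * ((starRingEnd ℝ) (2 * π)⁻¹ * ⟪x, ξ⟫_ℝ)) = ⟪x, ξ⟫_ℝ := by
      simp only [conj_trivial]
      field_simp
    rw [this, mul_comm Complex.I]
    ring
  simp_rw [h2]
  rw [integral_const_mul, Measure.integral_comp_smul]
  have h3 : ∫ v, G v = f x := h1
  rw [h3]
  simp only [finrank_euclideanSpace, Fintype.card_fin]
  rw [Complex.real_smul, ← mul_assoc, ← mul_assoc, ← Complex.ofReal_mul, ← Complex.ofReal_mul]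
  have hp : (0:ℝ) < 2 * π := by positivity
  have : ((2 * π) ^ (-(n : ℝ) / 2) * (2 * π) ^ (-(n : ℝ) / 2) * |(((2 * π)⁻¹ ^ n)⁻¹)| : ℝ) = 1 := by
    rw [← Real.rpow_add hp, abs_of_pos (by positivity), inv_pow, inv_inv, ← Real.rpow_natCast,
      ← Real.rpow_add hp]
    ring_nf
    simp
  rw [this]; simp

lemma aux_fmult_charFun {n : ℕ} (ν : Measure (EuclideanSpace ℝ (Fin n))) [IsFiniteMeasure ν]
    (f : SchwartzMap (EuclideanSpace ℝ (Fin n)) ℂ)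
    (x : EuclideanSpace ℝ (Fin n)) :
    fmult (charFun ν) (⇑f) x = ∫ y, f (x + y) ∂ν := by
  have h1 : ∀ ξ : EuclideanSpace ℝ (Fin n),
      Complex.exp (Complex.I * (⟪x, ξ⟫_ℝ : ℂ)) * charFun ν ξ * ft (⇑f) ξ =
      ∫ y, Complex.exp (Complex.I * (⟪x + y, ξ⟫_ℝ : ℂ)) * ft (⇑f) ξ ∂ν := by
    intro ξ
    rw [integral_mul_const, charFun_apply, ← integral_const_mul]
    congr 1
    apply integral_congr_ae
    refine Filter.Eventually.of_forall fun y => ?_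
    simp only
    rw [← Complex.exp_add, inner_add_left]
    push_cast
    ring_nf
  rw [fmult]
  simp_rw [h1]
  rw [integral_integral_swap, ← integral_const_mul]
  · simp_rw [aux_inversion]
  · have h := (aux_ft_integrable f).comp_fst ν
    refine Integrable.mono h ?_ ?_
    · refine AEStronglyMeasurable.mul ?_ h.1
      apply Continuous.aestronglyMeasurable
      fun_prop
    · refine Filter.Eventually.of_forall fun z => ?_
      simp only [Function.uncurry]
      rw [norm_mul, mul_comm Complex.I, Complex.norm_exp_ofReal_mul_I, one_mul]

lemma aux_eLpNorm {n : ℕ} (μ : Measure (EuclideanSpace ℝ (Fin n))) [IsFiniteMeasure μ]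
    (f : SchwartzMap (EuclideanSpace ℝ (Fin n)) ℂ) (g : EuclideanSpace ℝ (Fin n) → ℂ)
    (hg : ∀ x, ‖g x‖ₑ ≤ ∫⁻ y, ‖f (x + y)‖ₑ ∂μ) (p : ℝ≥0∞) (hp : 1 ≤ p) :
    eLpNorm g p volume ≤ μ Set.univ * eLpNorm (⇑f) p volume := by
  have hfc : Continuous f := f.continuous
  rcases eq_or_ne p ∞ with rfl | hpt
  · rw [eLpNorm_exponent_top, eLpNorm_exponent_top]
    refine eLpNormEssSup_le_of_ae_enorm_bound (Filter.Eventually.of_forall fun x => ?_)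
    refine (hg x).trans ?_
    have hb : ∀ z, ‖f z‖ₑ ≤ eLpNormEssSup (⇑f) volume := by
      intro z
      have hae := ae_le_eLpNormEssSup (f := (⇑f)) (μ := volume)
      have hcl : IsClosed {z | ‖f z‖ₑ ≤ eLpNormEssSup (⇑f) volume} :=
        isClosed_le (by fun_prop) continuous_const
      have hd : Dense {z | ‖f z‖ₑ ≤ eLpNormEssSup (⇑f) volume} := Measure.dense_of_ae hae
      have := hd.closure_eq
      rw [hcl.closure_eq] at this
      exact Set.eq_univ_iff_forall.mp this z
    calc ∫⁻ y, ‖f (x + y)‖ₑ ∂μ ≤ ∫⁻ y, eLpNormEssSup (⇑f) volume ∂μ :=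
          lintegral_mono fun y => hb _
      _ = _ := by rw [lintegral_const, mul_comm]
  · have hp0 : p ≠ 0 := (zero_lt_one.trans_le hp).ne'
    have hpr : 1 ≤ p.toReal := by
      rw [← ENNReal.toReal_one]; exact ENNReal.toReal_mono hpt hp
    have hpr0 : 0 < p.toReal := by linarith
    have key : ∀ x, ‖g x‖ₑ ^ p.toReal ≤
        (μ Set.univ) ^ (p.toReal - 1) * ∫⁻ y, ‖f (x + y)‖ₑ ^ p.toReal ∂μ := by
      intro x
      have h1 : eLpNorm (fun y => f (x + y)) 1 μ ≤ eLpNorm (fun y => f (x + y)) p μ *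
          μ Set.univ ^ (1 / (1 : ℝ≥0∞).toReal - 1 / p.toReal) :=
        eLpNorm_le_eLpNorm_mul_rpow_measure_univ hp
          (Continuous.aestronglyMeasurable (by fun_prop))
      rw [eLpNorm_one_eq_lintegral_enorm, eLpNorm_eq_lintegral_rpow_enorm_toReal hp0 hpt] at h1
      calc ‖g x‖ₑ ^ p.toReal ≤ _ := ENNReal.rpow_le_rpow ((hg x).trans h1) hpr0.le
        _ = _ := by
          rw [ENNReal.mul_rpow_of_nonneg _ _ hpr0.le, ← ENNReal.rpow_mul, ← ENNReal.rpow_mul,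
            mul_comm]
          congr 2
          · simp; field_simp
          · rw [one_div, inv_mul_cancel₀ hpr0.ne', ENNReal.rpow_one]
    rw [eLpNorm_eq_lintegral_rpow_enorm_toReal hp0 hpt,
      eLpNorm_eq_lintegral_rpow_enorm_toReal hp0 hpt]
    have h2 : ∫⁻ x, ‖g x‖ₑ ^ p.toReal ≤ (μ Set.univ) ^ p.toReal * ∫⁻ x, ‖f x‖ₑ ^ p.toReal := by
      calc ∫⁻ x, ‖g x‖ₑ ^ p.toReal ≤ ∫⁻ x, (μ Set.univ) ^ (p.toReal - 1) *
            ∫⁻ y, ‖f (x + y)‖ₑ ^ p.toReal ∂μ := lintegral_mono key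
        _ = (μ Set.univ) ^ (p.toReal - 1) * ∫⁻ x, ∫⁻ y, ‖f (x + y)‖ₑ ^ p.toReal ∂μ := by
            rw [lintegral_const_mul' _ _
              (ENNReal.rpow_ne_top_of_nonneg (by linarith) (measure_ne_top μ _))]
        _ = (μ Set.univ) ^ (p.toReal - 1) * ∫⁻ y, ∫⁻ x, ‖f (x + y)‖ₑ ^ p.toReal ∂volume ∂μ := by
            rw [lintegral_lintegral_swap]
            apply Measurable.aemeasurable
            apply Continuous.measurable
            exact ENNReal.continuous_rpow_const.comp (by fun_prop)
        _ = (μ Set.univ) ^ (p.toReal - 1) *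
              ((∫⁻ x, ‖f x‖ₑ ^ p.toReal) * μ Set.univ) := by
            congr 1
            rw [← lintegral_const]
            refine lintegral_congr fun y => ?_
            exact lintegral_add_right_eq_self (fun x => ‖f x‖ₑ ^ p.toReal) y
        _ = _ := by
            rw [mul_comm (lintegral _ _), ← mul_assoc]
            congr 1
            nth_rewrite 2 [← ENNReal.rpow_one (μ Set.univ)]
            rw [← ENNReal.rpow_add_of_nonneg _ _ (by linarith) zero_le_one]
            simp
    calc _ ≤ ((μ Set.univ) ^ p.toReal * ∫⁻ x, ‖f x‖ₑ ^ p.toReal) ^ (1 / p.toReal) :=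
          ENNReal.rpow_le_rpow h2 (by positivity)
      _ = _ := by
          rw [ENNReal.mul_rpow_of_nonneg _ _ (by positivity), ← ENNReal.rpow_mul,
            mul_one_div_cancel hpr0.ne', ENNReal.rpow_one]

lemma aux_choose_succ (s : ℝ) (k : ℕ) :
    ((k : ℝ) + 1) * Ring.choose s (k + 1) = (s - k) * Ring.choose s k := by
  have h1 := Ring.descPochhammer_eq_factorial_smul_choose s (k + 1)
  have h2 := Ring.descPochhammer_eq_factorial_smul_choose s k
  rw [descPochhammer_succ_right, Polynomial.smeval_mul, h2] at h1
  simp [Polynomial.smeval_natCast, Nat.factorial_succ] at h1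
  have : (Nat.factorial k : ℝ) ≠ 0 := by positivity
  apply mul_left_cancel₀ this
  linarith

lemma aux_choose_summable (s : ℝ) (hs : 0 < s) : Summable fun k : ℕ => |Ring.choose s k| := by
  obtain ⟨K, hK⟩ := exists_nat_ge s
  rw [← summable_nat_add_iff K]
  refine summable_of_sum_range_le (c := s⁻¹ * (K * |Ring.choose s K|)) (fun _ => abs_nonneg _) ?_
  intro N
  have h : ∀ N : ℕ, s * ∑ i ∈ Finset.range N, |Ring.choose s (i + K)| =
      K * |Ring.choose s K| - ((N : ℝ) + K) * |Ring.choose s (N + K)| := by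
    intro N
    induction N with
    | zero => simp
    | succ N ih =>
      rw [Finset.sum_range_succ, mul_add, ih]
      have h1 := congrArg abs (aux_choose_succ s (N + K))
      rw [abs_mul, abs_mul, abs_of_nonneg (a := ((N + K : ℕ) : ℝ) + 1) (by positivity),
        abs_of_nonpos (a := s - ((N + K : ℕ) : ℝ))] at h1
      · push_cast at h1 ⊢
        rw [show N + 1 + K = N + K + 1 by ring]
        linarith
      · push_cast
        have : (0:ℝ) ≤ N := by positivity
        linarith
  have h2 := h N
  have h3 : 0 ≤ ((N : ℝ) + K) * |Ring.choose s (N + K)| := by positivity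
  rw [← div_eq_inv_mul, le_div_iff₀ hs]
  linarith

lemma aux_binomial (s r : ℝ) (h0 : 0 ≤ r) (h1 : r < 1) :
    HasSum (fun k : ℕ => (Ring.choose s k * (-1) ^ k) * r ^ k) ((1 - r) ^ s) := by
  have h := (Real.one_add_rpow_hasFPowerSeriesOnBall_zero (a := s)).hasSum (y := -r) (by
    rw [← ENNReal.ofReal_one, Metric.eball_ofReal]
    simp [abs_of_nonneg h0, h1])
  simp only [binomialSeries_apply, zero_add] at h
  convert! h using 2 with k
  simp [neg_pow r, mul_assoc]

open ProbabilityTheory in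
lemma aux_exp_measure (E : Type*) [NormedAddCommGroup E] [InnerProductSpace ℝ E]
    [FiniteDimensional ℝ E] [MeasurableSpace E] [BorelSpace E] (a : ℝ) (ha : 0 ≤ a) :
    ∃ ν : Measure E, IsProbabilityMeasure ν ∧
      ∀ ξ, charFun ν ξ = (((1 + a * ‖ξ‖ ^ 2)⁻¹ : ℝ) : ℂ) := by
  have : IsProbabilityMeasure (expMeasure 1) := isProbabilityMeasure_expMeasure one_pos
  have hm : Measurable fun q : ℝ × E => √(2 * a * q.1) • q.2 := by fun_prop
  refine ⟨((expMeasure 1).prod (stdGaussian E)).map (fun q : ℝ × E => √(2 * a * q.1) • q.2),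
    Measure.isProbabilityMeasure_map hm.aemeasurable, fun ξ => ?_⟩
  rw [charFun_apply, integral_map hm.aemeasurable
    (Continuous.aestronglyMeasurable (by fun_prop)), integral_prod]
  swap
  · refine Integrable.mono (integrable_const (1:ℝ)) ?_ ?_
    · exact Continuous.aestronglyMeasurable (by fun_prop)
    · refine Filter.Eventually.of_forall fun z => ?_
      rw [Complex.norm_exp_ofReal_mul_I]; simp
  have h1 : ∀ t : ℝ, ∫ z, Complex.exp ((⟪√(2 * a * t) • z, ξ⟫_ℝ : ℂ) * Complex.I) ∂(stdGaussian E)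
      = ((Real.exp (- (√(2 * a * t) ^ 2 * ‖ξ‖ ^ 2) / 2) : ℝ) : ℂ) := by
    intro t
    have := charFun_stdGaussian (E := E) (√(2 * a * t) • ξ)
    rw [charFun_apply] at this
    simp_rw [inner_smul_right] at this
    simp_rw [inner_smul_left]
    simp only [conj_trivial]
    rw [this, norm_smul]
    rw [Real.norm_eq_abs, abs_of_nonneg (Real.sqrt_nonneg _), Complex.ofReal_exp]
    congr 1
    push_cast
    ring
  simp only []
  simp_rw [h1]
  rw [integral_complex_ofReal]
  congr 1
  have hpos : 0 < 1 + a * ‖ξ‖ ^ 2 := by positivity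
  have h2 := integral_exp_mul_Ioi (a := -(1 + a * ‖ξ‖ ^ 2)) (by linarith) 0
  simp only [mul_zero, Real.exp_zero] at h2
  rw [expMeasure, gammaMeasure, integral_withDensity_eq_integral_toReal_smul]
  · rw [show (1 + a * ‖ξ‖ ^ 2)⁻¹ = -1 / (-(1 + a * ‖ξ‖ ^ 2)) by field_simp, ← h2,
      ← integral_Ici_eq_integral_Ioi, ← integral_indicator measurableSet_Ici]
    apply integral_congr_ae
    refine Filter.Eventually.of_forall fun t => ?_
    simp only [Set.indicator, Set.mem_Ici, gammaPDF, gammaPDFReal]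
    split_ifs with ht
    · rw [ENNReal.toReal_ofReal (by simp; positivity), Real.sq_sqrt (by positivity)]
      simp [← Real.exp_add]
      ring
    · simp
  · exact measurable_gammaPDFReal 1 1 |>.ennreal_ofReal
  · simp [gammaPDF]

lemma aux_pow_measure {E : Type*} [NormedAddCommGroup E] [InnerProductSpace ℝ E]
    [FiniteDimensional ℝ E] [MeasurableSpace E] [BorelSpace E] (ν : Measure E)
    [IsProbabilityMeasure ν] (k : ℕ) :
    ∃ νk : Measure E, IsProbabilityMeasure νk ∧ ∀ ξ, charFun νk ξ = charFun ν ξ ^ k := by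
  induction k with
  | zero => exact ⟨Measure.dirac 0, inferInstance, fun ξ => by simp [charFun_dirac]⟩
  | succ k ih =>
    obtain ⟨νk, h1, h2⟩ := ih
    exact ⟨Measure.conv νk ν, inferInstance, fun ξ => by rw [charFun_conv, h2, pow_succ]⟩
/-- Boundedness of the multipliers `a^{α/2}|D|^α (1 + a|D|²)^{-α/2}` on `L^p(ℝⁿ)`,
`n = 1, 2`, uniformly in `a ≥ 0` and `p ∈ [1,∞]` (Lemma B.1, second bound). -/
theorem stmt4 (n : ℕ) (hn : n = 1 ∨ n = 2) (α : ℝ) (hα : 0 ≤ α) :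
    ∃ C : ℝ, 0 < C ∧ ∀ a : ℝ, 0 ≤ a → ∀ p : ℝ≥0∞, 1 ≤ p →
      ∀ f : SchwartzMap (EuclideanSpace ℝ (Fin n)) ℂ,
        eLpNorm
          (fmult (fun ξ =>
            ((a ^ (α / 2) * ‖ξ‖ ^ α * (1 + a * ‖ξ‖ ^ 2) ^ (-(α / 2)) : ℝ) : ℂ)) ⇑f) p volume ≤
          ENNReal.ofReal C * eLpNorm (⇑f) p volume := by
  have hn0 : 0 < n := by omega
  rcases hα.eq_or_lt with rfl | hαpos
  · refine ⟨1, one_pos, fun a ha p hp f => ?_⟩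
    have hm : (fun ξ : EuclideanSpace ℝ (Fin n) =>
        ((a ^ ((0:ℝ) / 2) * ‖ξ‖ ^ (0:ℝ) * (1 + a * ‖ξ‖ ^ 2) ^ (-((0:ℝ) / 2)) : ℝ) : ℂ)) =
        charFun (Measure.dirac (0 : EuclideanSpace ℝ (Fin n))) := by
      funext ξ
      simp [charFun_dirac]
    rw [hm]
    have h := aux_eLpNorm (Measure.dirac (0 : EuclideanSpace ℝ (Fin n))) f
      (fmult (charFun (Measure.dirac (0 : EuclideanSpace ℝ (Fin n)))) ⇑f)
      (fun x => by rw [aux_fmult_charFun]; exact enorm_integral_le_lintegral_enorm _) p hp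
    simpa using h
  have hs : 0 < α / 2 := by positivity
  have hsum := aux_choose_summable (α / 2) hs
  set A : ℕ → ℝ := fun k => Ring.choose (α / 2) k * (-1) ^ k with hA
  have hAabs : ∀ k, |A k| = |Ring.choose (α / 2) k| := fun k => by simp [hA, abs_mul]
  have hsumA : Summable fun k => |A k| := by simpa only [hAabs] using hsum
  have hC0 : 0 ≤ ∑' k, |A k| := tsum_nonneg fun _ => abs_nonneg _
  refine ⟨(∑' k, |A k|) + 1, by linarith, fun a ha p hp f => ?_⟩
  rcases ha.eq_or_lt with rfl | hapos
  · have hm : (fmult (fun ξ : EuclideanSpace ℝ (Fin n) =>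
        (((0:ℝ) ^ (α / 2) * ‖ξ‖ ^ α * (1 + 0 * ‖ξ‖ ^ 2) ^ (-(α / 2)) : ℝ) : ℂ)) ⇑f) =
        fun _ => 0 := by
      funext x
      simp [fmult, Real.zero_rpow hs.ne']
    rw [hm]
    simp
  obtain ⟨ν, hν, hchar⟩ := aux_exp_measure (EuclideanSpace ℝ (Fin n)) a ha
  choose νk hνk hchark using fun k => aux_pow_measure ν k
  set μ : Measure (EuclideanSpace ℝ (Fin n)) :=
    Measure.sum fun k => ENNReal.ofReal |A k| • νk k with hμ
  have hμu : μ Set.univ = ENNReal.ofReal (∑' k, |A k|) := by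
    rw [hμ, Measure.sum_apply _ MeasurableSet.univ,
      ENNReal.ofReal_tsum_of_nonneg (fun _ => abs_nonneg _) hsumA]
    simp
  have : IsFiniteMeasure μ := ⟨by rw [hμu]; exact ENNReal.ofReal_lt_top⟩
  refine (aux_eLpNorm μ f _ ?_ p hp).trans ?_
  swap
  · rw [hμu]
    gcongr
    linarith
  intro x
  have hnt : Nontrivial (EuclideanSpace ℝ (Fin n)) := by
    have : Nonempty (Fin n) := ⟨⟨0, hn0⟩⟩
    infer_instance
  have hseries : HasSum (fun k => (A k : ℂ) * fmult (charFun (νk k)) (⇑f) x)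
      (fmult (fun ξ =>
        ((a ^ (α / 2) * ‖ξ‖ ^ α * (1 + a * ‖ξ‖ ^ 2) ^ (-(α / 2)) : ℝ) : ℂ)) ⇑f x) := by
    have hI := hasSum_integral_of_dominated_convergence (μ := volume)
      (F := fun (k : ℕ) (ξ : EuclideanSpace ℝ (Fin n)) =>
        Complex.exp (Complex.I * (⟪x, ξ⟫_ℝ : ℂ)) * ((A k : ℂ) * charFun (νk k) ξ) * ft (⇑f) ξ)
      (f := fun ξ => Complex.exp (Complex.I * (⟪x, ξ⟫_ℝ : ℂ)) *
        ((a ^ (α / 2) * ‖ξ‖ ^ α * (1 + a * ‖ξ‖ ^ 2) ^ (-(α / 2)) : ℝ) : ℂ) * ft (⇑f) ξ)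
      (fun k ξ => |A k| * ‖ft (⇑f) ξ‖) ?_ ?_ ?_ ?_ ?_
    · have := hI.mul_left ((((2 * π) ^ (-(n : ℝ) / 2) : ℝ) : ℂ))
      convert! this using 2 with k
      rw [fmult, mul_left_comm, ← integral_const_mul]
      congr 2
      funext ξ
      ring
    · intro k
      refine AEStronglyMeasurable.mul (AEStronglyMeasurable.mul ?_ ?_) (aux_ft_integrable f).1
      · exact Continuous.aestronglyMeasurable (by fun_prop)
      · exact (measurable_charFun.aestronglyMeasurable).const_mul _
    · intro k
      refine Filter.Eventually.of_forall fun ξ => ?_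
      rw [norm_mul, norm_mul, norm_mul, mul_comm Complex.I, Complex.norm_exp_ofReal_mul_I, one_mul,
        Complex.norm_real, Real.norm_eq_abs]
      have : ‖charFun (νk k) ξ‖ ≤ 1 := norm_charFun_le_one ξ
      have h2 : |A k| * ‖charFun (νk k) ξ‖ ≤ |A k| * 1 := by gcongr
      rw [mul_one] at h2
      gcongr
    · exact Filter.Eventually.of_forall fun ξ => hsumA.mul_right _
    · simp_rw [tsum_mul_right]
      exact (aux_ft_integrable f).norm.const_mul _
    · have hne : ∀ᵐ ξ : EuclideanSpace ℝ (Fin n), ξ ≠ 0 := by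
        simp [ae_iff]
      filter_upwards [hne] with ξ hξ
      have hξ' : 0 < ‖ξ‖ := norm_pos_iff.mpr hξ
      have hpos : 0 < a * ‖ξ‖ ^ 2 := by positivity
      have hb := aux_binomial (α / 2) (1 + a * ‖ξ‖ ^ 2)⁻¹ (by positivity)
        (inv_lt_one_of_one_lt₀ (by linarith))
      have hval : (1 - (1 + a * ‖ξ‖ ^ 2)⁻¹) ^ (α / 2) =
          a ^ (α / 2) * ‖ξ‖ ^ α * (1 + a * ‖ξ‖ ^ 2) ^ (-(α / 2)) := by
        have h1 : 1 - (1 + a * ‖ξ‖ ^ 2)⁻¹ = a * ‖ξ‖ ^ 2 * (1 + a * ‖ξ‖ ^ 2)⁻¹ := by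
          field_simp
          ring
        rw [h1, Real.mul_rpow (by positivity) (by positivity),
          Real.mul_rpow (by positivity) (by positivity), Real.rpow_neg (by positivity),
          Real.inv_rpow (by positivity), ← Real.rpow_natCast, ← Real.rpow_mul (by positivity)]
        congr 3
        push_cast
        ring
      rw [hval] at hb
      have hbC := Complex.hasSum_ofReal.mpr hb
      refine HasSum.mul_right _ (HasSum.mul_left _ ?_)
      convert! hbC using 2 with k
      rw [hchark, hchar]
      push_cast [hA]
      ring
  rw [← hseries.tsum_eq]
  calc ‖∑' k, (A k : ℂ) * fmult (charFun (νk k)) (⇑f) x‖ₑ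
      ≤ ∑' k, ‖(A k : ℂ) * fmult (charFun (νk k)) (⇑f) x‖ₑ := enorm_tsum_le_tsum_enorm
    _ ≤ ∑' k, ENNReal.ofReal |A k| * ∫⁻ y, ‖f (x + y)‖ₑ ∂(νk k) := by
        refine ENNReal.tsum_le_tsum fun k => ?_
        rw [enorm_mul, aux_fmult_charFun]
        gcongr
        · rw [← ofReal_norm, Complex.norm_real, Real.norm_eq_abs]
        · exact enorm_integral_le_lintegral_enorm _
    _ = ∫⁻ y, ‖f (x + y)‖ₑ ∂μ := by
        rw [hμ, lintegral_sum_measure]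
        simp [lintegral_smul_measure]
end

section
/- Let n = 1 or n = 2. For every α ≥ 0 and every b > 0 there exists a constant C > 0 such that for every a ≥ 0, every p ∈ [1,∞] and every Schwartz function f on ℝⁿ, the Fourier multiplier with symbol (1 + b a|ξ|²)^{α/2} (1 + a|ξ|²)^{-α/2} satisfies ‖(1 + b a|D|²)^{α/2}(1 + a|D|²)^{-α/2} f‖_{L^p(ℝⁿ)} ≤ C ‖f‖_{L^p(ℝⁿ)}. -/
open MeasureTheory Real Complex
open scoped ENNReal InnerProductSpace

open Filter Topology

section aux
variable {n : ℕ}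

/-- Unnormalised inverse Fourier transform. -/
noncomputable def ivf (F : EuclideanSpace ℝ (Fin n) → ℂ) (x : EuclideanSpace ℝ (Fin n)) : ℂ :=
  ∫ ξ, Complex.exp (Complex.I * (⟪x, ξ⟫_ℝ : ℂ)) * F ξ

lemma norm_chr (x ξ : EuclideanSpace ℝ (Fin n)) :
    ‖Complex.exp (Complex.I * (⟪x, ξ⟫_ℝ : ℂ))‖ = 1 := by
  rw [mul_comm]; exact Complex.norm_exp_ofReal_mul_I _

lemma continuous_chr : Continuous (fun z : EuclideanSpace ℝ (Fin n) × EuclideanSpace ℝ (Fin n) =>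
    Complex.exp (Complex.I * (⟪z.1, z.2⟫_ℝ : ℂ))) := by fun_prop

lemma measurable_chr_comp {T : Type*} [MeasurableSpace T]
    {u v : T → EuclideanSpace ℝ (Fin n)} (hu : Measurable u) (hv : Measurable v) :
    Measurable (fun t => Complex.exp (Complex.I * (⟪u t, v t⟫_ℝ : ℂ))) := by
  have h := (hu.inner hv : Measurable fun t => ⟪u t, v t⟫_ℝ)
  exact Complex.measurable_exp.comp ((Complex.measurable_ofReal.comp h).const_mul _)

lemma integrable_chr_mul {F : EuclideanSpace ℝ (Fin n) → ℂ} (hF : Integrable F)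
    (x : EuclideanSpace ℝ (Fin n)) :
    Integrable (fun ξ => Complex.exp (Complex.I * (⟪x, ξ⟫_ℝ : ℂ)) * F ξ) := by
  refine hF.bdd_mul (c := 1) ?_ ?_
  · exact Continuous.aestronglyMeasurable (by fun_prop)
  · exact ae_of_all _ fun ξ => (norm_chr x ξ).le

/-- `IsB p m C`: the multiplier `m` is bounded on `L^p` with constant `C`. -/
structure IsB (p : ℝ≥0∞) (m : EuclideanSpace ℝ (Fin n) → ℂ) (C : NNReal) : Prop where
  meas : Measurable m
  bdd : ∀ ξ, ‖m ξ‖ ≤ C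
  le : ∀ F : EuclideanSpace ℝ (Fin n) → ℂ, Measurable F → Integrable F →
    eLpNorm (ivf (fun ξ => m ξ * F ξ)) p volume ≤ C * eLpNorm (ivf F) p volume

lemma IsB.integrable {p : ℝ≥0∞} {m : EuclideanSpace ℝ (Fin n) → ℂ} {C : NNReal} (h : IsB p m C)
    {F : EuclideanSpace ℝ (Fin n) → ℂ} (hF : Integrable F) :
    Integrable (fun ξ => m ξ * F ξ) :=
  hF.bdd_mul (c := C) h.meas.aestronglyMeasurable (ae_of_all _ h.bdd)

lemma measurable_ivf {F : EuclideanSpace ℝ (Fin n) → ℂ} (hF : Measurable F) :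
    StronglyMeasurable (ivf F) := by
  unfold ivf
  apply StronglyMeasurable.integral_prod_right'
    (f := fun z : EuclideanSpace ℝ (Fin n) × EuclideanSpace ℝ (Fin n) =>
      Complex.exp (Complex.I * (⟪z.1, z.2⟫_ℝ : ℂ)) * F z.2)
  exact (continuous_chr.measurable.mul (hF.comp measurable_snd)).stronglyMeasurable

lemma IsB.chr {p : ℝ≥0∞} (z : EuclideanSpace ℝ (Fin n)) :
    IsB p (fun ξ => Complex.exp (Complex.I * (⟪z, ξ⟫_ℝ : ℂ))) 1 where
  meas := Continuous.measurable (by fun_prop)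
  bdd ξ := (norm_chr z ξ).le
  le F hF hi := by
    have : ivf (fun ξ => Complex.exp (Complex.I * (⟪z, ξ⟫_ℝ : ℂ)) * F ξ)
        = ivf F ∘ (fun x => x + z) := by
      ext x
      simp only [ivf, Function.comp]
      congr 1; ext ξ
      rw [← mul_assoc, ← Complex.exp_add, inner_add_left]
      push_cast; ring_nf
    rw [this, eLpNorm_comp_measurePreserving (measurable_ivf hF).aestronglyMeasurable
      (measurePreserving_add_right volume z)]
    simp

lemma ivf_const_mul (c : ℂ) (F : EuclideanSpace ℝ (Fin n) → ℂ) :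
    ivf (fun ξ => c * F ξ) = c • ivf F := by
  ext x
  simp only [ivf, Pi.smul_apply, smul_eq_mul, ← integral_const_mul]
  congr 1; ext ξ; ring

lemma IsB.const {p : ℝ≥0∞} (c : ℂ) :
    IsB p (fun _ : EuclideanSpace ℝ (Fin n) => c) ‖c‖₊ where
  meas := measurable_const
  bdd ξ := le_rfl
  le F hF hi := by
    rw [ivf_const_mul, eLpNorm_const_smul]; rfl

lemma IsB.mul {p : ℝ≥0∞} {m m' : EuclideanSpace ℝ (Fin n) → ℂ} {C C' : NNReal} (h : IsB p m C)
    (h' : IsB p m' C') : IsB p (fun ξ => m ξ * m' ξ) (C * C') where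
  meas := h.meas.mul h'.meas
  bdd ξ := by
    rw [norm_mul]; push_cast
    exact mul_le_mul (h.bdd ξ) (h'.bdd ξ) (norm_nonneg _) C.2
  le F hF hi := by
    simp only [mul_assoc]
    refine (h.le _ (h'.meas.mul hF) (h'.integrable hi)).trans ?_
    push_cast
    rw [mul_assoc]
    gcongr
    exact h'.le F hF hi

lemma IsB.add {p : ℝ≥0∞} (hp : 1 ≤ p) {m m' : EuclideanSpace ℝ (Fin n) → ℂ} {C C' : NNReal}
    (h : IsB p m C) (h' : IsB p m' C') : IsB p (fun ξ => m ξ + m' ξ) (C + C') where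
  meas := h.meas.add h'.meas
  bdd ξ := (norm_add_le _ _).trans (by push_cast; exact add_le_add (h.bdd ξ) (h'.bdd ξ))
  le F hF hi := by
    have : ivf (fun ξ => (m ξ + m' ξ) * F ξ)
        = ivf (fun ξ => m ξ * F ξ) + ivf (fun ξ => m' ξ * F ξ) := by
      ext x
      simp only [ivf, Pi.add_apply]
      rw [← integral_add (integrable_chr_mul (h.integrable hi) x)
        (integrable_chr_mul (h'.integrable hi) x)]
      congr 1; ext ξ; ring
    rw [this]
    refine (eLpNorm_add_le (measurable_ivf (h.meas.mul hF)).aestronglyMeasurable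
      (measurable_ivf (h'.meas.mul hF)).aestronglyMeasurable hp).trans ?_
    push_cast
    rw [add_mul]
    exact add_le_add (h.le F hF hi) (h'.le F hF hi)

lemma IsB.pow {p : ℝ≥0∞} {m : EuclideanSpace ℝ (Fin n) → ℂ} {C : NNReal} (h : IsB p m C) (k : ℕ) :
    IsB p (fun ξ => m ξ ^ k) (C ^ k) := by
  induction k with
  | zero => simpa using IsB.const (n := n) (p := p) 1
  | succ k ih => simpa only [pow_succ] using ih.mul h

lemma IsB.mono {p : ℝ≥0∞} {m : EuclideanSpace ℝ (Fin n) → ℂ} {C C' : NNReal} (h : IsB p m C)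
    (hC : C ≤ C') : IsB p m C' where
  meas := h.meas
  bdd ξ := (h.bdd ξ).trans (by exact_mod_cast hC)
  le F hF hi := (h.le F hF hi).trans (by gcongr)

lemma IsB.lim {p : ℝ≥0∞} {m : EuclideanSpace ℝ (Fin n) → ℂ} {M : ℕ → EuclideanSpace ℝ (Fin n) → ℂ}
    {C : NNReal} (h : ∀ k, IsB p (M k) C) (hl : ∀ ξ, Tendsto (fun k => M k ξ) atTop (𝓝 (m ξ))) :
    IsB p m C where
  meas := measurable_of_tendsto_metrizable (fun k => (h k).meas) (tendsto_pi_nhds.2 hl)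
  bdd ξ := le_of_tendsto (hl ξ).norm (Eventually.of_forall fun k => (h k).bdd ξ)
  le F hF hi := by
    refine (Lp.eLpNorm_lim_le_liminf_eLpNorm (f := fun k => ivf (fun ξ => M k ξ * F ξ))
      (fun k => (measurable_ivf ((h k).meas.mul hF)).aestronglyMeasurable) _
      (ae_of_all _ fun x => ?_)).trans ?_
    · refine tendsto_integral_of_dominated_convergence (fun ξ => C * ‖F ξ‖) 
        (fun k => (integrable_chr_mul ((h k).integrable hi) x).aestronglyMeasurable)
        (hi.norm.const_mul _) (fun k => ae_of_all _ fun ξ => ?_) (ae_of_all _ fun ξ => ?_)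
      · rw [norm_mul, norm_chr, one_mul, norm_mul]
        gcongr
        exact (h k).bdd ξ
      · exact ((hl ξ).mul_const _).const_mul _
    · refine liminf_le_of_le (by isBoundedDefault) (fun b hb => ?_)
      obtain ⟨k, hk⟩ := hb.exists
      exact hk.trans ((h k).le F hF hi)

lemma eLpNorm_avg {Ω : Type*} [MeasurableSpace Ω] (ν : Measure Ω) [IsProbabilityMeasure ν]
    {p : ℝ≥0∞} (hp : 1 ≤ p) (Φ : Ω → EuclideanSpace ℝ (Fin n) → ℂ)
    (hΦ : Measurable (Function.uncurry Φ)) (M : ℝ≥0∞)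
    (h : ∀ᵐ ω ∂ν, eLpNorm (Φ ω) p volume ≤ M) :
    eLpNorm (fun x => ∫ ω, Φ ω x ∂ν) p volume ≤ M := by
  have hx : ∀ x, Measurable (fun ω => Φ ω x) := fun x => hΦ.comp measurable_prodMk_right
  by_cases htop : p = ∞
  · subst htop
    simp only [eLpNorm_exponent_top] at *
    have h1 : ∀ᵐ ω ∂ν, ∀ᵐ x ∂(volume : Measure (EuclideanSpace ℝ (Fin n))), ‖Φ ω x‖ₑ ≤ M := by
      filter_upwards [h] with ω hω
      filter_upwards [enorm_ae_le_eLpNormEssSup (Φ ω) volume] with x hx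
      exact hx.trans hω
    have hms : MeasurableSet {z : Ω × EuclideanSpace ℝ (Fin n) | ‖Φ z.1 z.2‖ₑ ≤ M} :=
      measurableSet_le hΦ.enorm measurable_const
    rw [Measure.ae_ae_comm hms] at h1
    refine essSup_le_of_ae_le _ ?_
    filter_upwards [h1] with x hx
    refine (enorm_integral_le_lintegral_enorm _).trans ((lintegral_mono_ae hx).trans ?_)
    simp
  · have hp0 : p ≠ 0 := (zero_lt_one.trans_le hp).ne'
    have hpr : 0 < p.toReal := ENNReal.toReal_pos hp0 htop
    have key : ∀ x, ‖∫ ω, Φ ω x ∂ν‖ₑ ^ p.toReal ≤ ∫⁻ ω, ‖Φ ω x‖ₑ ^ p.toReal ∂ν := by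
      intro x
      have h1 : ‖∫ ω, Φ ω x ∂ν‖ₑ ≤ eLpNorm (fun ω => Φ ω x) p ν := by
        refine (enorm_integral_le_lintegral_enorm _).trans ?_
        rw [← eLpNorm_one_eq_lintegral_enorm]
        exact eLpNorm_le_eLpNorm_of_exponent_le hp (hx x).aestronglyMeasurable
      rw [lintegral_rpow_enorm_eq_rpow_eLpNorm' hpr, ← eLpNorm_eq_eLpNorm' hp0 htop]
      gcongr
    have h2 : eLpNorm (fun x => ∫ ω, Φ ω x ∂ν) p volume ^ p.toReal ≤ M ^ p.toReal := by
      rw [eLpNorm_eq_eLpNorm' hp0 htop, ← lintegral_rpow_enorm_eq_rpow_eLpNorm' hpr]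
      refine (lintegral_mono key).trans ?_
      rw [lintegral_lintegral_swap]
      · calc _ ≤ ∫⁻ ω, M ^ p.toReal ∂ν := by
              refine lintegral_mono_ae ?_
              filter_upwards [h] with ω hω
              rw [lintegral_rpow_enorm_eq_rpow_eLpNorm' hpr, ← eLpNorm_eq_eLpNorm' hp0 htop]
              gcongr
          _ = _ := by simp
      · exact ((hΦ.comp measurable_swap).enorm.pow_const _).aemeasurable
    exact (ENNReal.rpow_le_rpow_iff hpr).1 h2

lemma IsB.avg {Ω : Type*} [MeasurableSpace Ω] (ν : Measure Ω) [IsProbabilityMeasure ν]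
    {p : ℝ≥0∞} (hp : 1 ≤ p) {m : Ω → EuclideanSpace ℝ (Fin n) → ℂ} {C : NNReal}
    (hm : Measurable (Function.uncurry m)) (h : ∀ᵐ ω ∂ν, IsB p (m ω) C) :
    IsB p (fun ξ => ∫ ω, m ω ξ ∂ν) C where
  meas := by
    apply StronglyMeasurable.measurable
    apply StronglyMeasurable.integral_prod_right'
      (f := fun z : EuclideanSpace ℝ (Fin n) × Ω => m z.2 z.1)
    exact (hm.comp measurable_swap).stronglyMeasurable
  bdd ξ := by
    refine (norm_integral_le_of_norm_le_const (C := C) ?_).trans (by simp)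
    filter_upwards [h] with ω hω using hω.bdd ξ
  le F hF hi := by
    have hm1 : Measurable (fun z : Ω × EuclideanSpace ℝ (Fin n) => m z.1 z.2) := hm
    have hmm (x : EuclideanSpace ℝ (Fin n)) :
        Measurable (fun z : Ω × EuclideanSpace ℝ (Fin n) =>
          Complex.exp (Complex.I * (⟪x, z.2⟫_ℝ : ℂ)) * (m z.1 z.2 * F z.2)) := by
      have h1 : Measurable (fun z : Ω × EuclideanSpace ℝ (Fin n) => z.2) := measurable_snd
      have h2 : Measurable (fun z : Ω × EuclideanSpace ℝ (Fin n) => F z.2) := hF.comp h1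
      exact Measurable.mul (measurable_chr_comp measurable_const h1) (Measurable.mul hm1 h2)
    have : ivf (fun ξ => (∫ ω, m ω ξ ∂ν) * F ξ)
        = fun x => ∫ ω, ivf (fun ξ => m ω ξ * F ξ) x ∂ν := by
      ext x
      simp only [ivf]
      rw [integral_integral_swap]
      · congr 1; ext ξ
        rw [← integral_mul_const, ← integral_const_mul]
      · have hint : Integrable (fun z : Ω × EuclideanSpace ℝ (Fin n) => (C : ℝ) * ‖F z.2‖)
            (ν.prod volume) := (hi.norm.const_mul _).comp_snd ν
        refine hint.mono' ?_ ?_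
        · exact (hmm x).aestronglyMeasurable
        · have hbd : ∀ᵐ z ∂(ν.prod (volume : Measure (EuclideanSpace ℝ (Fin n)))),
              ∀ ξ, ‖m z.1 ξ‖ ≤ C :=
            Measure.quasiMeasurePreserving_fst.ae (h.mono fun ω hω => hω.bdd)
          filter_upwards [hbd] with z hz
          simp only [Function.uncurry]
          rw [norm_mul, norm_chr, one_mul, norm_mul]
          gcongr
          exact hz _
    rw [this]
    refine eLpNorm_avg ν hp _ ?_ _ ?_
    · apply StronglyMeasurable.measurable
      unfold ivf
      apply StronglyMeasurable.integral_prod_right'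
        (f := fun z : (Ω × EuclideanSpace ℝ (Fin n)) × EuclideanSpace ℝ (Fin n) =>
          Complex.exp (Complex.I * (⟪z.1.2, z.2⟫_ℝ : ℂ)) * (m z.1.1 z.2 * F z.2))
      apply Measurable.stronglyMeasurable
      have h1 : Measurable (fun z : (Ω × EuclideanSpace ℝ (Fin n)) × EuclideanSpace ℝ (Fin n) =>
        z.1.2) := by fun_prop
      have h2 : Measurable (fun z : (Ω × EuclideanSpace ℝ (Fin n)) × EuclideanSpace ℝ (Fin n) =>
        z.2) := by fun_prop
      have h3 : Measurable (fun z : (Ω × EuclideanSpace ℝ (Fin n)) × EuclideanSpace ℝ (Fin n) =>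
        (z.1.1, z.2)) := by fun_prop
      have h4 : Measurable (fun z : (Ω × EuclideanSpace ℝ (Fin n)) × EuclideanSpace ℝ (Fin n) =>
        m z.1.1 z.2) := hm1.comp h3
      have h5 : Measurable (fun z : (Ω × EuclideanSpace ℝ (Fin n)) × EuclideanSpace ℝ (Fin n) =>
        F z.2) := hF.comp h2
      exact Measurable.mul (measurable_chr_comp h1 h2) (Measurable.mul h4 h5)
    · filter_upwards [h] with ω hω using hω.le F hF hi

lemma IsB.gauss {p : ℝ≥0∞} (hp : 1 ≤ p) {c : ℝ} (hc : 0 ≤ c) :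
    IsB p (fun ξ : EuclideanSpace ℝ (Fin n) => ((Real.exp (-(c * ‖ξ‖ ^ 2)) : ℝ) : ℂ)) 1 := by
  have h := IsB.avg (n := n) (ProbabilityTheory.stdGaussian (EuclideanSpace ℝ (Fin n))) hp
    (m := fun y ξ => Complex.exp (Complex.I * (⟪√(2 * c) • y, ξ⟫_ℝ : ℂ))) (C := 1)
    (Continuous.measurable (by
      have : Continuous fun z : EuclideanSpace ℝ (Fin n) × EuclideanSpace ℝ (Fin n) =>
        Complex.exp (Complex.I * (⟪√(2 * c) • z.1, z.2⟫_ℝ : ℂ)) := by fun_prop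
      exact this))
    (ae_of_all _ fun y => IsB.chr _)
  convert h using 2 with ξ
  have h2 := ProbabilityTheory.charFun_stdGaussian (√(2 * c) • ξ)
  rw [charFun_apply] at h2
  have e : ∀ y : EuclideanSpace ℝ (Fin n), Complex.exp (Complex.I * (⟪√(2 * c) • y, ξ⟫_ℝ : ℂ))
      = Complex.exp ((⟪y, √(2 * c) • ξ⟫_ℝ : ℂ) * Complex.I) := by
    intro y
    rw [real_inner_smul_left, real_inner_smul_right, mul_comm]
  simp only [e]
  rw [h2, Complex.ofReal_exp]
  congr 1
  rw [norm_smul, ← Complex.ofReal_pow, mul_pow, Real.norm_eq_abs, sq_abs, Real.sq_sqrt (by positivity)]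
  push_cast
  ring

instance probIoc : IsProbabilityMeasure ((volume : Measure ℝ).restrict (Set.Ioc 0 1)) :=
  ⟨by simp⟩

lemma IsB.resolvent {p : ℝ≥0∞} (hp : 1 ≤ p) {s : ℝ} (hs : 0 ≤ s) :
    IsB p (fun ξ : EuclideanSpace ℝ (Fin n) => (((1 + s * ‖ξ‖ ^ 2)⁻¹ : ℝ) : ℂ)) 1 := by
  have h := IsB.avg (n := n) ((volume : Measure ℝ).restrict (Set.Ioc 0 1)) hp
    (m := fun q ξ => ((q ^ (s * ‖ξ‖ ^ 2) : ℝ) : ℂ)) (C := 1)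
    (by
      have : Measurable fun z : ℝ × EuclideanSpace ℝ (Fin n) =>
        ((z.1 ^ (s * ‖z.2‖ ^ 2) : ℝ) : ℂ) := by fun_prop
      exact this)
    (by
      filter_upwards [ae_restrict_mem measurableSet_Ioc] with q hq
      have := IsB.gauss (n := n) hp (c := -Real.log q * s)
        (mul_nonneg (neg_nonneg.2 (Real.log_nonpos hq.1.le hq.2)) hs)
      convert this using 3 with ξ
      rw [Real.rpow_def_of_pos hq.1]
      congr 1; ring)
  convert h using 2 with ξ
  rw [integral_complex_ofReal, ← intervalIntegral.integral_of_le zero_le_one]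
  have h0 : 0 ≤ s * ‖ξ‖ ^ 2 := by positivity
  rw [integral_rpow (Or.inl (by linarith)), Real.one_rpow, Real.zero_rpow (by linarith)]
  congr 1
  rw [sub_zero, one_div, add_comm]

lemma IsB.quot {p : ℝ≥0∞} (hp : 1 ≤ p) {a v : ℝ} {c : NNReal} (ha : 0 ≤ a) (hc : 0 < c)
    (hv : c ≤ v) :
    IsB p (fun ξ : EuclideanSpace ℝ (Fin n) =>
      ((a * ‖ξ‖ ^ 2 / (1 + v * (a * ‖ξ‖ ^ 2)) : ℝ) : ℂ)) (c⁻¹ * 2) := by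
  have hc' : (0 : ℝ) < c := hc
  have hv0 : 0 < v := hc'.trans_le hv
  have h1 := IsB.resolvent (n := n) hp (s := v * a) (by positivity)
  have h2 := (IsB.const (n := n) (p := p) ((v⁻¹ : ℝ) : ℂ)).mul
    ((IsB.const (n := n) (p := p) 1).add hp ((IsB.const (n := n) (p := p) (-1)).mul h1))
  have h3 := h2.mono (C' := c⁻¹ * 2) (by
    simp only [nnnorm_neg, nnnorm_one, mul_one]
    have : ‖((v⁻¹ : ℝ) : ℂ)‖₊ ≤ c⁻¹ := by
      rw [← NNReal.coe_le_coe, coe_nnnorm, Complex.norm_real, Real.norm_of_nonneg (by positivity)]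
      push_cast
      gcongr
    calc _ ≤ c⁻¹ * (1 + 1) := by gcongr
      _ = _ := by norm_num)
  convert h3 using 2 with ξ
  have h0 : 0 ≤ a * ‖ξ‖ ^ 2 := by positivity
  have h4 : 1 + v * (a * ‖ξ‖ ^ 2) ≠ 0 := by positivity
  have h5 : a * ‖ξ‖ ^ 2 / (1 + v * (a * ‖ξ‖ ^ 2))
     = v⁻¹ * (1 + -1 * (1 + v * a * ‖ξ‖ ^ 2)⁻¹) := by
    rw [mul_assoc v a]
    field_simp
    ring
  rw [h5]; push_cast; rfl

lemma log_integral {b t : ℝ} (hb : 0 < b) (ht : 0 ≤ t) :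
    ∫ θ in (0:ℝ)..1, (b - 1) * (t / (1 + (1 + θ * (b - 1)) * t))
      = Real.log ((1 + b * t) / (1 + t)) := by
  have hpos : ∀ θ ∈ Set.uIcc (0:ℝ) 1, 0 < 1 + (1 + θ * (b - 1)) * t := by
    intro θ hθ
    rw [Set.uIcc_of_le zero_le_one] at hθ
    have : 0 ≤ 1 + θ * (b - 1) := by nlinarith [hθ.1, hθ.2, mul_nonneg hθ.1 hb.le]
    positivity
  rw [intervalIntegral.integral_eq_sub_of_hasDerivAt
    (f := fun θ => Real.log (1 + (1 + θ * (b - 1)) * t))]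
  · rw [Real.log_div (by positivity) (by positivity)]
    congr 2 <;> ring
  · intro θ hθ
    have h1 : HasDerivAt (fun θ : ℝ => 1 + (1 + θ * (b - 1)) * t) ((b - 1) * t) θ := by
      have := ((((hasDerivAt_id θ).mul_const (b - 1)).const_add 1).mul_const t).const_add 1
      simpa using this
    have h2 := h1.log (hpos θ hθ).ne'
    rw [mul_div_assoc] at h2
    exact h2
  · apply ContinuousOn.intervalIntegrable
    refine ContinuousOn.mul continuousOn_const (ContinuousOn.div continuousOn_const ?_ ?_)
    · exact Continuous.continuousOn (by fun_prop)
    · intro θ hθ; exact (hpos θ hθ).ne'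

lemma IsB.log {p : ℝ≥0∞} (hp : 1 ≤ p) {a b : ℝ} {c : NNReal} (ha : 0 ≤ a) (hc : 0 < c)
    (hc1 : (c : ℝ) ≤ 1) (hcb : c ≤ b) :
    IsB p (fun ξ : EuclideanSpace ℝ (Fin n) =>
      ((Real.log ((1 + b * (a * ‖ξ‖ ^ 2)) / (1 + a * ‖ξ‖ ^ 2)) : ℝ) : ℂ))
      (‖((b - 1 : ℝ) : ℂ)‖₊ * (c⁻¹ * 2)) := by
  have hc' : (0 : ℝ) < c := hc
  have h := IsB.avg (n := n) ((volume : Measure ℝ).restrict (Set.Ioc 0 1)) hp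
    (m := fun θ ξ => (((b - 1) * (a * ‖ξ‖ ^ 2 / (1 + (1 + θ * (b - 1)) * (a * ‖ξ‖ ^ 2))) : ℝ) : ℂ))
    (C := ‖((b - 1 : ℝ) : ℂ)‖₊ * (c⁻¹ * 2))
    (by
      have : Measurable fun z : ℝ × EuclideanSpace ℝ (Fin n) =>
        (((b - 1) * (a * ‖z.2‖ ^ 2 / (1 + (1 + z.1 * (b - 1)) * (a * ‖z.2‖ ^ 2))) : ℝ) : ℂ) := by
        fun_prop
      exact this)
    (by
      filter_upwards [ae_restrict_mem measurableSet_Ioc] with θ hθ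
      have := (IsB.const (n := n) (p := p) ((b - 1 : ℝ) : ℂ)).mul
        (IsB.quot (n := n) hp (a := a) (v := 1 + θ * (b - 1)) ha hc
          (by nlinarith [hθ.1, hθ.2]))
      simpa only [Complex.ofReal_mul] using this)
  convert h using 2 with ξ
  rw [integral_complex_ofReal, ← intervalIntegral.integral_of_le zero_le_one,
    log_integral (hc'.trans_le hcb) (by positivity)]

lemma IsB.expo {p : ℝ≥0∞} (hp : 1 ≤ p) {h : EuclideanSpace ℝ (Fin n) → ℂ} {C : NNReal}
    (hh : IsB p h C) : IsB p (fun ξ => Complex.exp (h ξ)) (Real.toNNReal (Real.exp C)) := by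
  refine IsB.lim (M := fun k ξ => (1 + h ξ / k) ^ k) (fun k => ?_)
    (fun ξ => Complex.tendsto_one_add_div_pow_exp _)
  have h1 := ((IsB.const (n := n) (p := p) 1).add hp
    (hh.mul (IsB.const (n := n) (p := p) ((k : ℂ)⁻¹)))).pow k
  refine IsB.mono (by simpa only [div_eq_mul_inv] using h1) ?_
  rw [← NNReal.coe_le_coe, Real.coe_toNNReal _ (Real.exp_pos _).le]
  push_cast
  rw [norm_one, norm_inv, Complex.norm_natCast, add_comm]
  calc ((C : ℝ) * (k : ℝ)⁻¹ + 1) ^ k ≤ Real.exp (C * (k : ℝ)⁻¹) ^ k := by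
        gcongr
        exact Real.add_one_le_exp _
    _ = Real.exp (k * (C * (k : ℝ)⁻¹)) := by rw [← Real.exp_nat_mul]
    _ ≤ _ := by
        apply Real.exp_le_exp.2
        rcases Nat.eq_zero_or_pos k with rfl | hk
        · simp
        · have : (k : ℝ) ≠ 0 := by positivity
          field_simp
          exact le_rfl

lemma ft_eq (f : EuclideanSpace ℝ (Fin n) → ℂ) (ξ : EuclideanSpace ℝ (Fin n)) :
    ft f ξ = (((2 * π) ^ (-(n : ℝ) / 2) : ℝ) : ℂ) * FourierTransform.fourier f ((2 * π)⁻¹ • ξ) := by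
  rw [ft, Real.fourier_eq']
  congr 2
  ext x
  rw [smul_eq_mul, real_inner_smul_right]
  congr 2
  have : (π : ℂ) ≠ 0 := by exact_mod_cast Real.pi_ne_zero
  push_cast
  field_simp

lemma ft_props (f : SchwartzMap (EuclideanSpace ℝ (Fin n)) ℂ) :
    Measurable (ft f) ∧ Integrable (ft f) := by
  have e : ft f = fun ξ => (((2 * π) ^ (-(n : ℝ) / 2) : ℝ) : ℂ) *
      (FourierTransform.fourier f) ((2 * π)⁻¹ • ξ) := by
    ext ξ; rw [ft_eq, SchwartzMap.fourier_coe]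
  rw [e]
  constructor
  · refine Continuous.measurable (continuous_const.mul ?_)
    exact (FourierTransform.fourier f).continuous.comp (by fun_prop)
  · refine Integrable.const_mul ?_ _
    exact (FourierTransform.fourier f).integrable.comp_smul (by positivity)

lemma ivf_ft (f : SchwartzMap (EuclideanSpace ℝ (Fin n)) ℂ) :
    (fun x => (((2 * π) ^ (-(n : ℝ) / 2) : ℝ) : ℂ) * ivf (ft f) x) = f := by
  ext x
  have h1 : ivf (ft f) x = (((2 * π) ^ (-(n : ℝ) / 2) : ℝ) : ℂ) *
      ∫ ξ, (fun η : EuclideanSpace ℝ (Fin n) =>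
        Complex.exp ((2 * π * ⟪η, x⟫_ℝ : ℝ) * Complex.I) • (FourierTransform.fourier f) η)
        ((2 * π)⁻¹ • ξ) := by
    rw [ivf, ← integral_const_mul]
    congr 1; ext ξ
    rw [ft_eq, ← SchwartzMap.fourier_coe]
    beta_reduce
    rw [smul_eq_mul, real_inner_smul_left]
    have : 2 * π * ((2 * π)⁻¹ * ⟪ξ, x⟫_ℝ) = ⟪ξ, x⟫_ℝ := by
      field_simp
    rw [this, real_inner_comm]
    ring_nf
  rw [h1, Measure.integral_comp_smul volume (fun η : EuclideanSpace ℝ (Fin n) =>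
        Complex.exp ((2 * π * ⟪η, x⟫_ℝ : ℝ) * Complex.I) • (FourierTransform.fourier f) η)
        ((2 * π)⁻¹), ← Real.fourierInv_eq', ← SchwartzMap.fourierInv_coe,
    FourierTransform.fourierInv_fourier_eq, finrank_euclideanSpace_fin, ← mul_assoc,
    Complex.real_smul, ← mul_assoc, ← Complex.ofReal_mul, ← Complex.ofReal_mul]
  have hp : 0 < 2 * π := by positivity
  have : (2 * π) ^ (-(n : ℝ) / 2) * (2 * π) ^ (-(n : ℝ) / 2) * |(((2 * π)⁻¹) ^ n)⁻¹| = 1 := by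
    rw [← Real.rpow_add hp, inv_pow, inv_inv, abs_of_pos (by positivity), ← Real.rpow_natCast,
      ← Real.rpow_add hp]
    ring_nf
    simp
  rw [this]; simp

end aux

/-- Boundedness of the multipliers `(1 + b a|D|²)^{α/2} (1 + a|D|²)^{-α/2}` on `L^p(ℝⁿ)`,
`n = 1, 2`, uniformly in `a ≥ 0` and `p ∈ [1,∞]` (Lemma B.1, third bound). -/
theorem stmt5 (n : ℕ) (hn : n = 1 ∨ n = 2) (α : ℝ) (hα : 0 ≤ α) (b : ℝ) (hb : 0 < b) :
    ∃ C : ℝ, 0 < C ∧ ∀ a : ℝ, 0 ≤ a → ∀ p : ℝ≥0∞, 1 ≤ p →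
      ∀ f : SchwartzMap (EuclideanSpace ℝ (Fin n)) ℂ,
        eLpNorm
          (fmult (fun ξ =>
            (((1 + b * a * ‖ξ‖ ^ 2) ^ (α / 2) * (1 + a * ‖ξ‖ ^ 2) ^ (-(α / 2)) : ℝ) : ℂ)) ⇑f)
          p volume ≤
          ENNReal.ofReal C * eLpNorm (⇑f) p volume := by
  obtain ⟨c, hc, hc1, hcb⟩ : ∃ c : NNReal, 0 < c ∧ (c : ℝ) ≤ 1 ∧ c ≤ b :=
    ⟨Real.toNNReal (min 1 b), Real.toNNReal_pos.2 (lt_min one_pos hb), by simp, by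
      rw [Real.coe_toNNReal _ (le_min zero_le_one hb.le)]; exact min_le_right _ _⟩
  refine ⟨Real.exp ((‖((α / 2 : ℝ) : ℂ)‖₊ * (‖((b - 1 : ℝ) : ℂ)‖₊ * (c⁻¹ * 2)) : NNReal) : ℝ),
    Real.exp_pos _, ?_⟩
  intro a ha p hp f
  have hB := ((IsB.const (n := n) (p := p) ((α / 2 : ℝ) : ℂ)).mul
    (IsB.log (n := n) hp ha hc hc1 hcb)).expo hp
  have hle := hB.le (ft f) (ft_props f).1 (ft_props f).2
  have e1 : fmult (fun ξ =>
      (((1 + b * a * ‖ξ‖ ^ 2) ^ (α / 2) * (1 + a * ‖ξ‖ ^ 2) ^ (-(α / 2)) : ℝ) : ℂ)) ⇑f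
      = (((2 * π) ^ (-(n : ℝ) / 2) : ℝ) : ℂ) • ivf (fun ξ => Complex.exp (((α / 2 : ℝ) : ℂ) *
        ((Real.log ((1 + b * (a * ‖ξ‖ ^ 2)) / (1 + a * ‖ξ‖ ^ 2)) : ℝ) : ℂ)) * ft f ξ) := by
    ext x
    simp only [fmult, ivf, Pi.smul_apply, smul_eq_mul]
    congr 2; ext ξ
    rw [mul_assoc, ← Complex.ofReal_mul, ← Complex.ofReal_exp]
    congr 3
    have h1 : 0 < 1 + b * (a * ‖ξ‖ ^ 2) := by positivity
    have h2 : 0 < 1 + a * ‖ξ‖ ^ 2 := by positivity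
    rw [mul_assoc b a, Real.rpow_def_of_pos h1, Real.rpow_def_of_pos h2, ← Real.exp_add,
      Real.log_div h1.ne' h2.ne']
    congr 1; ring
  have e2 : (f : EuclideanSpace ℝ (Fin n) → ℂ)
      = (((2 * π) ^ (-(n : ℝ) / 2) : ℝ) : ℂ) • ivf (ft f) := by
    conv_lhs => rw [← ivf_ft f]
    rfl
  rw [e1]
  conv_rhs => rw [e2]
  rw [eLpNorm_const_smul, eLpNorm_const_smul, mul_left_comm]
  gcongr
  exact hle
end

section
/- Let s ∈ [0,1). There exists a constant C_s > 0 such that for every Schwartz function f on ℝ one has ‖|D|^s f‖_{L¹(ℝ)} ≤ C_s (‖f‖_{L¹(ℝ)} + ‖f'‖_{L¹(ℝ)}). -/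
open MeasureTheory Real Complex
open scoped ENNReal

/-- One-dimensional Fourier transform with the convention
`f̂(ξ) = (2π)^{-1/2} ∫ e^{-i x ξ} f(x) dx`. -/
noncomputable def ft1 (f : ℝ → ℂ) (ξ : ℝ) : ℂ :=
  (((2 * π) ^ (-(1 : ℝ) / 2) : ℝ) : ℂ) * ∫ x : ℝ, Complex.exp (-Complex.I * (x * ξ : ℝ)) * f x

/-- One-dimensional Fourier multiplier `m(D) f (x) = (2π)^{-1/2} ∫ e^{i x ξ} m(ξ) f̂(ξ) dξ`. -/
noncomputable def fmult1 (m : ℝ → ℂ) (f : ℝ → ℂ) (x : ℝ) : ℂ :=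
  (((2 * π) ^ (-(1 : ℝ) / 2) : ℝ) : ℂ) *
    ∫ ξ : ℝ, Complex.exp (Complex.I * (x * ξ : ℝ)) * m ξ * ft1 f ξ

lemma w_int (s : ℝ) (hs0 : 0 < s) (hs1 : s < 1) :
    IntegrableOn (fun t : ℝ => min 2 t * t ^ (-1 - s)) (Set.Ioi 0) := by
  have hm : Measurable (fun t : ℝ => min 2 t * t ^ (-1 - s)) := by fun_prop
  rw [← Set.Ioc_union_Ioi_eq_Ioi (zero_le_one : (0:ℝ) ≤ 1)]
  refine IntegrableOn.union ?_ ?_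
  · have h := (intervalIntegral.intervalIntegrable_rpow' (a := 0) (b := 1)
      (show -1 < -s by linarith)).1
    refine h.congr_fun ?_ measurableSet_Ioc
    intro t ht
    have h1 : min 2 t = t := min_eq_right (by linarith [ht.2])
    simp only [h1]
    rw [show -s = 1 + (-1 - s) by ring, Real.rpow_add ht.1, Real.rpow_one]
  · have h := (integrableOn_Ioi_rpow_of_lt (show -1 - s < -1 by linarith) zero_lt_one).const_mul 2
    refine Integrable.mono' h hm.aestronglyMeasurable ?_
    refine (ae_restrict_iff' measurableSet_Ioi).2 (Filter.Eventually.of_forall fun t ht => ?_)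
    have ht' : (0:ℝ) < t := lt_trans zero_lt_one ht
    have hp := Real.rpow_pos_of_pos ht' (-1 - s)
    rw [Real.norm_of_nonneg (by positivity)]
    gcongr
    exact min_le_left _ _

lemma one_sub_cos_le (u : ℝ) (hu : 0 ≤ u) : 1 - Real.cos u ≤ min 2 u := by
  refine le_min (by linarith [Real.neg_one_le_cos u]) ?_
  by_cases h : u ≤ 2
  · nlinarith [Real.one_sub_sq_div_two_le_cos (x := u)]
  · linarith [Real.neg_one_le_cos u]

lemma k_int (s : ℝ) (hs0 : 0 < s) (hs1 : s < 1) :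
    IntegrableOn (fun t : ℝ => (1 - Real.cos t) * t ^ (-1 - s)) (Set.Ioi 0) := by
  refine Integrable.mono' (w_int s hs0 hs1)
    (Measurable.aestronglyMeasurable (by fun_prop)) ?_
  refine (ae_restrict_iff' measurableSet_Ioi).2 (Filter.Eventually.of_forall fun t ht => ?_)
  have ht' : (0:ℝ) < t := ht
  have hp := Real.rpow_pos_of_pos ht' (-1 - s)
  have := Real.cos_le_one t
  rw [Real.norm_of_nonneg (mul_nonneg (by linarith) hp.le)]
  exact mul_le_mul_of_nonneg_right (one_sub_cos_le t ht'.le) hp.le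

lemma k_pos (s : ℝ) (hs0 : 0 < s) (hs1 : s < 1) :
    0 < ∫ t in Set.Ioi (0:ℝ), (1 - Real.cos t) * t ^ (-1 - s) := by
  rw [setIntegral_pos_iff_support_of_nonneg_ae _ (k_int s hs0 hs1)]
  · refine lt_of_lt_of_le ?_ (measure_mono (s := Set.Ioo (0:ℝ) 1) ?_)
    · simp
    · intro t ht
      refine ⟨?_, ht.1⟩
      have hp := Real.rpow_pos_of_pos ht.1 (-1 - s)
      have h2 : Real.cos t < Real.cos 0 :=
        Real.cos_lt_cos_of_nonneg_of_le_pi le_rfl (by linarith [ht.2, Real.pi_gt_three]) ht.1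
      rw [Real.cos_zero] at h2
      have : 0 < (1 - Real.cos t) * t ^ (-1 - s) := mul_pos (by linarith) hp
      exact this.ne'
  · refine (ae_restrict_iff' measurableSet_Ioi).2 (Filter.Eventually.of_forall fun t ht => ?_)
    have ht' : (0:ℝ) < t := ht
    have hp := Real.rpow_pos_of_pos ht' (-1 - s)
    exact mul_nonneg (by linarith [Real.cos_le_one t]) hp.le

lemma k_scale_aux (s b t : ℝ) (hb : 0 < b) (ht : 0 < t) :
    (1 - Real.cos (t * b)) * t ^ (-1 - s) =
      b ^ (1 + s) * ((1 - Real.cos (b * t)) * (b * t) ^ (-1 - s)) := by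
  rw [Real.mul_rpow hb.le ht.le, mul_comm t b, show (-1 - s) = -(1 + s) by ring,
    Real.rpow_neg hb.le]
  have := (Real.rpow_pos_of_pos hb (1 + s)).ne'
  field_simp

lemma k_scale (s : ℝ) (hs0 : 0 < s) (hs1 : s < 1) (ξ : ℝ) :
    IntegrableOn (fun t : ℝ => (1 - Real.cos (t * ξ)) * t ^ (-1 - s)) (Set.Ioi 0) ∧
    ∫ t in Set.Ioi (0:ℝ), (1 - Real.cos (t * ξ)) * t ^ (-1 - s) =
      |ξ| ^ s * ∫ t in Set.Ioi (0:ℝ), (1 - Real.cos t) * t ^ (-1 - s) := by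
  by_cases h0 : ξ = 0
  · subst h0; simp [Real.zero_rpow hs0.ne']
  have hb : 0 < |ξ| := abs_pos.2 h0
  have habs : ∀ t : ℝ, Real.cos (t * ξ) = Real.cos (t * |ξ|) := by
    intro t
    rcases abs_choice ξ with h | h <;> rw [h]
    rw [mul_neg, Real.cos_neg]
  simp only [habs]
  generalize |ξ| = b at hb
  have hEq : Set.EqOn (fun t : ℝ => b ^ (1 + s) * ((1 - Real.cos (b * t)) * (b * t) ^ (-1 - s)))
      (fun t : ℝ => (1 - Real.cos (t * b)) * t ^ (-1 - s)) (Set.Ioi 0) :=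
    fun t ht => (k_scale_aux s b t hb ht).symm
  constructor
  · refine IntegrableOn.congr_fun ?_ hEq measurableSet_Ioi
    refine Integrable.const_mul ?_ _
    have := (integrableOn_Ioi_comp_mul_left_iff
      (fun t : ℝ => (1 - Real.cos t) * t ^ (-1 - s)) 0 hb).2
        (by simpa using k_int s hs0 hs1)
    exact this
  · rw [← setIntegral_congr_fun measurableSet_Ioi hEq, integral_const_mul,
      integral_comp_mul_left_Ioi (fun t : ℝ => (1 - Real.cos t) * t ^ (-1 - s)) 0 hb,
      mul_zero, smul_eq_mul, ← mul_assoc, Real.rpow_add hb, Real.rpow_one]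
    field_simp

open scoped FourierTransform in
lemma ft1_eq (f : SchwartzMap ℝ ℂ) (ξ : ℝ) :
    ft1 f ξ = (((2 * π) ^ (-(1 : ℝ) / 2) : ℝ) : ℂ) * (𝓕 f) (ξ / (2 * π)) := by
  rw [ft1, SchwartzMap.fourier_coe, Real.fourier_real_eq_integral_exp_smul]
  congr 1
  refine integral_congr_ae (Filter.Eventually.of_forall fun x => ?_)
  simp only [smul_eq_mul]
  congr 2
  rw [show -2 * π * x * (ξ / (2 * π)) = -(x * ξ) by field_simp]
  push_cast; ring

lemma const_sq : (((2 * π) ^ (-(1 : ℝ) / 2) : ℝ) : ℂ) * (((2 * π) ^ (-(1 : ℝ) / 2) : ℝ) : ℂ)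
    = (((2 * π)⁻¹ : ℝ) : ℂ) := by
  rw [← Complex.ofReal_mul, ← Real.rpow_add (by positivity)]
  norm_num [Real.rpow_neg_one]

lemma ft1_cont (f : SchwartzMap ℝ ℂ) : Continuous (ft1 f) := by
  rw [funext (ft1_eq f)]
  have := (FourierTransform.fourier f : SchwartzMap ℝ ℂ).continuous
  fun_prop

lemma ft1_int (f : SchwartzMap ℝ ℂ) (k : ℕ) :
    Integrable (fun ξ : ℝ => |ξ| ^ k * ‖ft1 f ξ‖) := by
  have h := ((FourierTransform.fourier f : SchwartzMap ℝ ℂ).integrable_pow_mul volume k).comp_div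
    (R := 2 * π) (by positivity)
  refine (h.const_mul ((2 * π) ^ k * (2 * π) ^ (-(1 : ℝ) / 2))).congr
    (Filter.Eventually.of_forall fun ξ => ?_)
  have : (0:ℝ) < 2 * π := by positivity
  simp only [ft1_eq, norm_mul, Complex.norm_real, Real.norm_eq_abs, abs_div]
  rw [abs_of_pos this, abs_of_pos (Real.rpow_pos_of_pos this _), div_pow]
  field_simp

lemma ft1_integrable (f : SchwartzMap ℝ ℂ) : Integrable (ft1 f) := by
  have h := ft1_int f 0
  simp only [pow_zero, one_mul] at h
  exact (integrable_norm_iff (ft1_cont f).aestronglyMeasurable).1 h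

lemma exp_ft1_integrable (f : SchwartzMap ℝ ℂ) (x : ℝ) :
    Integrable (fun ξ : ℝ => Complex.exp (Complex.I * (x * ξ : ℝ)) * ft1 f ξ) := by
  refine (ft1_integrable f).norm.mono' ?_ (Filter.Eventually.of_forall fun ξ => ?_)
  · have := ft1_cont f
    exact Continuous.aestronglyMeasurable (by fun_prop)
  · rw [norm_mul, mul_comm Complex.I, Complex.norm_exp_ofReal_mul_I, one_mul]

open scoped FourierTransform in
lemma inv_ft1 (f : SchwartzMap ℝ ℂ) (x : ℝ) :
    (((2 * π) ^ (-(1 : ℝ) / 2) : ℝ) : ℂ) *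
      ∫ ξ : ℝ, Complex.exp (Complex.I * (x * ξ : ℝ)) * ft1 f ξ = f x := by
  have h : f x = 𝓕⁻ (𝓕 f) x := by simp
  rw [h, SchwartzMap.fourierInv_coe, Real.fourierInv_eq', ← integral_const_mul]
  have h2 := Measure.integral_comp_div
    (fun v : ℝ => Complex.exp (((2 * π * inner ℝ v x : ℝ) : ℂ) * Complex.I) • (𝓕 f) v) (2 * π)
  have hp : (0:ℝ) < 2 * π := by positivity
  rw [abs_of_pos hp] at h2
  rw [← inv_smul_smul₀ hp.ne' (∫ v : ℝ, _ • _), ← h2, ← integral_smul]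
  refine integral_congr_ae (Filter.Eventually.of_forall fun ξ => ?_)
  simp only [ft1_eq, smul_eq_mul, Complex.real_smul, ← const_sq]
  rw [show (2 * π * inner ℝ (ξ / (2 * π)) x : ℝ) = x * ξ by
    simp; field_simp, mul_comm Complex.I]
  ring

lemma inv_cos (f : SchwartzMap ℝ ℂ) (x t : ℝ) :
    (((2 * π) ^ (-(1 : ℝ) / 2) : ℝ) : ℂ) *
      ∫ ξ : ℝ, Complex.exp (Complex.I * (x * ξ : ℝ)) * ((1 - Real.cos (t * ξ) : ℝ) : ℂ) * ft1 f ξ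
      = f x - (f (x + t) + f (x - t)) / 2 := by
  rw [← inv_ft1 f x, ← inv_ft1 f (x + t), ← inv_ft1 f (x - t), ← mul_add, mul_div_assoc,
    ← mul_sub, ← integral_add (exp_ft1_integrable f _) (exp_ft1_integrable f _),
    ← integral_div, ← integral_sub (exp_ft1_integrable f _)
      (Integrable.div_const (f := fun ξ : ℝ => Complex.exp (Complex.I * ((x + t) * ξ : ℝ)) *
        ft1 f ξ + Complex.exp (Complex.I * ((x - t) * ξ : ℝ)) * ft1 f ξ)
        ((exp_ft1_integrable f _).add (exp_ft1_integrable f _)) _)]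
  congr 1
  refine integral_congr_ae (Filter.Eventually.of_forall fun ξ => ?_)
  simp only
  have h1 : Complex.exp (Complex.I * ((x + t) * ξ : ℝ)) =
      Complex.exp (Complex.I * (x * ξ : ℝ)) * Complex.exp (((t * ξ : ℝ) : ℂ) * Complex.I) := by
    rw [← Complex.exp_add]; congr 1; push_cast; ring
  have h2 : Complex.exp (Complex.I * ((x - t) * ξ : ℝ)) =
      Complex.exp (Complex.I * (x * ξ : ℝ)) * Complex.exp (-((t * ξ : ℝ) : ℂ) * Complex.I) := by
    rw [← Complex.exp_add]; congr 1; push_cast; ring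
  rw [h1, h2, Complex.ofReal_sub, Complex.ofReal_cos, Complex.cos, Complex.ofReal_one]
  ring

/-- pointwise formula -/
lemma pointwise (s : ℝ) (hs0 : 0 < s) (hs1 : s < 1) (f : SchwartzMap ℝ ℂ) (x : ℝ) :
    ((∫ t in Set.Ioi (0:ℝ), (1 - Real.cos t) * t ^ (-1 - s) : ℝ) : ℂ) *
      fmult1 (fun ξ => ((|ξ| ^ s : ℝ) : ℂ)) f x =
    ∫ t in Set.Ioi (0:ℝ), ((t ^ (-1 - s) : ℝ) : ℂ) * (f x - (f (x + t) + f (x - t)) / 2) := by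
  set K := ∫ t in Set.Ioi (0:ℝ), (1 - Real.cos t) * t ^ (-1 - s) with hK
  let F : ℝ → ℝ → ℂ := fun ξ t => Complex.exp (Complex.I * (x * ξ : ℝ)) *
    (((1 - Real.cos (t * ξ)) * t ^ (-1 - s) : ℝ) : ℂ) * ft1 f ξ
  have hcont := ft1_cont f
  have hmeas : Measurable (ft1 f) := hcont.measurable
  have hFm : Measurable (Function.uncurry F) := by
    simp only [F, Function.uncurry_def]
    fun_prop
  have hnorm : ∀ ξ, ∀ t ∈ Set.Ioi (0:ℝ), ‖F ξ t‖ =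
      ((1 - Real.cos (t * ξ)) * t ^ (-1 - s)) * ‖ft1 f ξ‖ := by
    intro ξ t ht
    have ht' : (0:ℝ) < t := ht
    have hp := Real.rpow_pos_of_pos ht' (-1 - s)
    simp only [F]
    rw [norm_mul, norm_mul, mul_comm Complex.I, Complex.norm_exp_ofReal_mul_I, one_mul,
      Complex.norm_real, Real.norm_of_nonneg
        (mul_nonneg (by linarith [Real.cos_le_one (t * ξ)]) hp.le)]
  have hFint : Integrable (Function.uncurry F)
      ((volume : Measure ℝ).prod (volume.restrict (Set.Ioi (0:ℝ)))) := by
    rw [integrable_prod_iff hFm.aestronglyMeasurable]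
    constructor
    · refine Filter.Eventually.of_forall fun ξ => ?_
      have h1 : Integrable (fun t : ℝ => (((1 - Real.cos (t * ξ)) * t ^ (-1 - s) : ℝ) : ℂ))
          (volume.restrict (Set.Ioi 0)) := Integrable.ofReal (𝕜 := ℂ) (k_scale s hs0 hs1 ξ).1
      exact (h1.const_mul (Complex.exp (Complex.I * (x * ξ : ℝ)))).mul_const (ft1 f ξ)
    · have : (fun ξ => ∫ t in Set.Ioi (0:ℝ), ‖Function.uncurry F (ξ, t)‖) =
          fun ξ => (|ξ| ^ s * ‖ft1 f ξ‖) * K := by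
        funext ξ
        simp only [Function.uncurry_apply_pair]
        rw [setIntegral_congr_fun measurableSet_Ioi (hnorm ξ), integral_mul_const,
          (k_scale s hs0 hs1 ξ).2]
        ring
      rw [this]
      refine Integrable.mul_const ?_ _
      refine ((ft1_int f 0).add (ft1_int f 1)).mono'
        (Measurable.aestronglyMeasurable (by fun_prop)) (Filter.Eventually.of_forall fun ξ => ?_)
      have h0 := Real.rpow_nonneg (abs_nonneg ξ) s
      rw [Real.norm_of_nonneg (by positivity)]
      simp only [Pi.add_apply, pow_zero, pow_one, ← add_mul]
      gcongr
      by_cases h : |ξ| ≤ 1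
      · have := Real.rpow_le_one (abs_nonneg ξ) h hs0.le
        linarith [abs_nonneg ξ]
      · have := Real.rpow_le_rpow_of_exponent_le (le_of_not_ge h) hs1.le
        rw [Real.rpow_one] at this
        linarith
  have hswap := integral_integral_swap hFint
  have hL : ∀ ξ, ∫ t in Set.Ioi (0:ℝ), F ξ t =
      (K : ℂ) * (Complex.exp (Complex.I * (x * ξ : ℝ)) * ((|ξ| ^ s : ℝ) : ℂ) * ft1 f ξ) := by
    intro ξ
    simp only [F]
    rw [integral_mul_const, integral_const_mul, integral_complex_ofReal, (k_scale s hs0 hs1 ξ).2, ← hK]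
    push_cast
    ring
  have hR : ∀ t, (((2 * π) ^ (-(1 : ℝ) / 2) : ℝ) : ℂ) * ∫ ξ, F ξ t =
      ((t ^ (-1 - s) : ℝ) : ℂ) * (f x - (f (x + t) + f (x - t)) / 2) := by
    intro t
    rw [← inv_cos, mul_left_comm, ← integral_const_mul ((t ^ (-1 - s) : ℝ) : ℂ)]
    congr 1
    refine integral_congr_ae (Filter.Eventually.of_forall fun ξ => ?_)
    simp only [F]
    push_cast
    ring
  simp only [← hR]
  rw [integral_const_mul, ← hswap, fmult1, mul_left_comm, ← integral_const_mul]
  simp only [hL]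

lemma diff_le_deriv (f : SchwartzMap ℝ ℂ) (t : ℝ) (ht : 0 < t) :
    ∫⁻ x, ‖f (x + t) - f x‖ₑ ≤ ENNReal.ofReal t * ∫⁻ x, ‖deriv f x‖ₑ := by
  have hd : Continuous (deriv f) := (f.smooth 1).continuous_deriv le_rfl
  have hpt : ∀ x, ‖f (x + t) - f x‖ₑ ≤ ∫⁻ u in Set.Ioc 0 t, ‖deriv f (x + u)‖ₑ := by
    intro x
    have h1 : ∫ u in (0:ℝ)..t, deriv f (x + u) = f (x + t) - f x := by
      rw [intervalIntegral.integral_comp_add_left (fun u => deriv f u) x, add_zero]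
      exact intervalIntegral.integral_deriv_eq_sub (fun y _ => f.differentiableAt)
        (hd.intervalIntegrable _ _)
    rw [← h1, intervalIntegral.integral_of_le ht.le]
    exact enorm_integral_le_lintegral_enorm _
  calc ∫⁻ x, ‖f (x + t) - f x‖ₑ ≤ ∫⁻ x, ∫⁻ u in Set.Ioc 0 t, ‖deriv f (x + u)‖ₑ :=
        lintegral_mono hpt
    _ = ∫⁻ u in Set.Ioc 0 t, ∫⁻ x, ‖deriv f (x + u)‖ₑ := by
        refine lintegral_lintegral_swap ?_
        have : Continuous (Function.uncurry fun x u : ℝ => ‖deriv f (x + u)‖ₑ) := by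
          simp only [Function.uncurry_def]
          fun_prop
        exact this.measurable.aemeasurable
    _ = ∫⁻ u in Set.Ioc 0 t, ∫⁻ x, ‖deriv f x‖ₑ := by
        congr 1; funext u
        exact lintegral_add_right_eq_self (fun x => ‖deriv f x‖ₑ) u
    _ = _ := by
        rw [setLIntegral_const, Real.volume_Ioc, sub_zero, mul_comm]

lemma diff_le_two (f : SchwartzMap ℝ ℂ) (t : ℝ) :
    ∫⁻ x, ‖f (x + t) - f x‖ₑ ≤ 2 * ∫⁻ x, ‖f x‖ₑ := by
  have hc := f.continuous
  calc ∫⁻ x, ‖f (x + t) - f x‖ₑ ≤ ∫⁻ x, (‖f (x + t)‖ₑ + ‖f x‖ₑ) :=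
        lintegral_mono fun x => enorm_sub_le
    _ = _ := by
        rw [lintegral_add_right _ (by fun_prop),
          lintegral_add_right_eq_self (fun x => ‖f x‖ₑ) t, two_mul]

lemma diff_le (f : SchwartzMap ℝ ℂ) (t : ℝ) (ht : 0 < t) :
    ∫⁻ x, ‖f (x + t) - f x‖ₑ ≤
      ENNReal.ofReal (min 2 t) * ((∫⁻ x, ‖f x‖ₑ) + ∫⁻ x, ‖deriv f x‖ₑ) := by
  rcases min_choice 2 t with h | h <;> rw [h]
  · refine (diff_le_two f t).trans ?_
    rw [ENNReal.ofReal_ofNat]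
    gcongr
    exact le_self_add
  · refine (diff_le_deriv f t ht).trans ?_
    gcongr
    exact le_add_self

lemma sym_le (f : SchwartzMap ℝ ℂ) (t : ℝ) (ht : 0 < t) :
    ∫⁻ x, ‖f x - (f (x + t) + f (x - t)) / 2‖ₑ ≤
      2 * (ENNReal.ofReal (min 2 t) * ((∫⁻ x, ‖f x‖ₑ) + ∫⁻ x, ‖deriv f x‖ₑ)) := by
  have hc := f.continuous
  have hpt : ∀ x, ‖f x - (f (x + t) + f (x - t)) / 2‖ₑ ≤
      ‖f (x + t) - f x‖ₑ + ‖f (x - t + t) - f (x - t)‖ₑ := by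
    intro x
    rw [sub_add_cancel]
    have : f x - (f (x + t) + f (x - t)) / 2 =
      (2⁻¹ : ℂ) * ((f x - f (x - t)) - (f (x + t) - f x)) := by ring
    rw [this, enorm_mul, add_comm ‖f (x + t) - f x‖ₑ]
    calc _ ≤ 1 * ‖(f x - f (x - t)) - (f (x + t) - f x)‖ₑ := by
          refine mul_le_mul_left ?_ _
          rw [← enorm_one (G := ℂ), enorm_le_iff_norm_le]
          norm_num
      _ ≤ _ := by rw [one_mul]; exact enorm_sub_le
  refine (lintegral_mono hpt).trans ?_
  rw [lintegral_add_right _ (by fun_prop),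
    lintegral_sub_right_eq_self (fun x => ‖f (x + t) - f x‖ₑ) t, ← two_mul]
  gcongr
  exact diff_le f t ht

/-- `‖|D|^s f‖_{L¹(ℝ)} ≤ C_s ‖f‖_{W^{1,1}(ℝ)}` for `s ∈ [0,1)` (Lemma B.4, first bound). -/
theorem stmt7 (s : ℝ) (hs0 : 0 ≤ s) (hs1 : s < 1) :
    ∃ C : ℝ, 0 < C ∧ ∀ f : SchwartzMap ℝ ℂ,
      eLpNorm (fmult1 (fun ξ => ((|ξ| ^ s : ℝ) : ℂ)) ⇑f) 1 volume ≤
        ENNReal.ofReal C * (eLpNorm (⇑f) 1 volume + eLpNorm (deriv ⇑f) 1 volume) := by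
  simp only [eLpNorm_one_eq_lintegral_enorm]
  rcases hs0.eq_or_lt with h0 | h0
  · subst h0
    refine ⟨1, one_pos, fun f => ?_⟩
    have : fmult1 (fun ξ => ((|ξ| ^ (0:ℝ) : ℝ) : ℂ)) f = f := by
      funext x
      rw [fmult1, ← inv_ft1 f x]
      simp
    rw [this, ENNReal.ofReal_one, one_mul]
    exact le_self_add
  set K := ∫ t in Set.Ioi (0:ℝ), (1 - Real.cos t) * t ^ (-1 - s) with hK
  have hKpos : 0 < K := k_pos s h0 hs1
  set W := ∫ t in Set.Ioi (0:ℝ), min 2 t * t ^ (-1 - s) with hW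
  have hWn : 0 ≤ W := setIntegral_nonneg measurableSet_Ioi fun t ht => by
    have ht' : (0:ℝ) < t := ht
    positivity
  have hWl : ENNReal.ofReal W = ∫⁻ t in Set.Ioi (0:ℝ), ENNReal.ofReal (min 2 t * t ^ (-1 - s)) := by
    refine ofReal_integral_eq_lintegral_ofReal (w_int s h0 hs1) ?_
    refine (ae_restrict_iff' measurableSet_Ioi).2 (Filter.Eventually.of_forall fun t ht => ?_)
    have ht' : (0:ℝ) < t := ht
    simp only [Pi.zero_apply]
    positivity
  refine ⟨K⁻¹ * (2 * W) + 1, by positivity, fun f => ?_⟩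
  have hc := f.continuous
  set N := (∫⁻ x, ‖f x‖ₑ) + ∫⁻ x, ‖deriv f x‖ₑ with hN
  have hpt : ∀ x, ‖fmult1 (fun ξ => ((|ξ| ^ s : ℝ) : ℂ)) f x‖ₑ ≤ ENNReal.ofReal K⁻¹ *
      ∫⁻ t in Set.Ioi (0:ℝ), ENNReal.ofReal (t ^ (-1 - s)) *
        ‖f x - (f (x + t) + f (x - t)) / 2‖ₑ := by
    intro x
    have h1 := pointwise s h0 hs1 f x
    rw [← hK] at h1
    have hKc : (K : ℂ) ≠ 0 := by exact_mod_cast hKpos.ne'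
    have h2 : fmult1 (fun ξ => ((|ξ| ^ s : ℝ) : ℂ)) f x = ((K⁻¹ : ℝ) : ℂ) *
      ∫ t in Set.Ioi (0:ℝ), ((t ^ (-1 - s) : ℝ) : ℂ) * (f x - (f (x + t) + f (x - t)) / 2) := by
      rw [← h1, Complex.ofReal_inv, inv_mul_cancel_left₀ hKc]
    have hofr : ∀ r : ℝ, 0 ≤ r → ‖(r : ℂ)‖ₑ = ENNReal.ofReal r := by
      intro r hr
      rw [← ofReal_norm, Complex.norm_real, Real.norm_of_nonneg hr]
    rw [h2, enorm_mul, hofr _ (by positivity)]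
    gcongr
    refine (enorm_integral_le_lintegral_enorm _).trans (le_of_eq ?_)
    refine setLIntegral_congr_fun measurableSet_Ioi fun t ht => ?_
    have ht' : (0:ℝ) < t := ht
    rw [enorm_mul, hofr _ (by positivity)]
  calc ∫⁻ x, ‖fmult1 (fun ξ => ((|ξ| ^ s : ℝ) : ℂ)) f x‖ₑ
      ≤ ∫⁻ x, ENNReal.ofReal K⁻¹ * ∫⁻ t in Set.Ioi (0:ℝ), ENNReal.ofReal (t ^ (-1 - s)) *
        ‖f x - (f (x + t) + f (x - t)) / 2‖ₑ := lintegral_mono hpt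
    _ = ENNReal.ofReal K⁻¹ * ∫⁻ t in Set.Ioi (0:ℝ), ∫⁻ x, ENNReal.ofReal (t ^ (-1 - s)) *
        ‖f x - (f (x + t) + f (x - t)) / 2‖ₑ := by
      rw [lintegral_const_mul' _ _ ENNReal.ofReal_ne_top, lintegral_lintegral_swap]
      have hm := hc.measurable
      have : Measurable (Function.uncurry fun x t : ℝ => ENNReal.ofReal (t ^ (-1 - s)) *
        ‖f x - (f (x + t) + f (x - t)) / 2‖ₑ) := by
        simp only [Function.uncurry_def]
        fun_prop
      exact this.aemeasurable
    _ ≤ ENNReal.ofReal K⁻¹ * ∫⁻ t in Set.Ioi (0:ℝ),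
        ENNReal.ofReal (min 2 t * t ^ (-1 - s)) * (2 * N) := by
      refine mul_le_mul_right ?_ _
      refine setLIntegral_mono' measurableSet_Ioi fun t ht => ?_
      have ht' : (0:ℝ) < t := ht
      rw [lintegral_const_mul' _ _ ENNReal.ofReal_ne_top, ENNReal.ofReal_mul (by positivity)]
      refine (mul_le_mul_right (sym_le f t ht') _).trans (le_of_eq ?_)
      rw [← hN]
      ring
    _ = ENNReal.ofReal (K⁻¹ * (2 * W)) * N := by
      rw [lintegral_mul_const _ (by fun_prop), ← hWl, ENNReal.ofReal_mul (by positivity),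
        ENNReal.ofReal_mul (by positivity), ENNReal.ofReal_ofNat]
      ring
    _ ≤ _ := by
      gcongr
      linarith
end
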